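/- Let n ≥ 1 and ν > 0. Let N_1, …, N_{n+1} be unit vectors in ℝ^{n+1} with |det(N_1, …, N_{n+1})| ≥ ν. For each i let 𝓗_i = {x ∈ ℝ^{n+1} : ⟨x, N_i⟩ = 0} and let π_{N_i} : ℝ^{n+1} → 𝓗_i be the orthogonal projection. Let 𝓛 = {z_1 N_1 + ⋯ + z_{n+1} N_{n+1} : z ∈ ℤ^{n+1}} and 𝓛(𝓗_i) = π_{N_i}(𝓛). Then there is a constant C = C(n, ν) such that for all g_i ∈ l²(𝓛(𝓗_i)), i = 1,…,n+1: (∑_{z ∈ 𝓛} ∏_{i=1}^{n+1} |g_i(π_{N_i}(z))|^{2/n})^{n/2} ≤ C ∏_{i=1}^{n+1} ‖g_i‖_{l²(𝓛(𝓗_i))}. -/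

import Mathlib

open MeasureTheory
open scoped InnerProductSpace ENNReal BigOperators

/-- The oblique lattice `𝓛 = {z_1 N_1 + ⋯ + z_d N_d : z ∈ ℤ^d}` generated by the
vectors `N_1, …, N_d`. -/
noncomputable def obliqueLattice {d : ℕ} (N : Fin d → EuclideanSpace ℝ (Fin d)) :
    Set (EuclideanSpace ℝ (Fin d)) :=
  Set.range fun z : Fin d → ℤ => ∑ i, (z i : ℝ) • N i

/-- The orthogonal projection onto the hyperplane `{x : ⟪x, v⟫ = 0}` with unit normal `v`. -/
noncomputable def hypProj {d : ℕ} (v : EuclideanSpace ℝ (Fin d))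
    (x : EuclideanSpace ℝ (Fin d)) : EuclideanSpace ℝ (Fin d) :=
  x - ⟪x, v⟫_ℝ • v

theorem ENNReal.tsum_mul_rpow_le {α : Type*} (f g : α → ℝ≥0∞) {p q : ℝ}
    (hp : 0 ≤ p) (hq : 0 ≤ q) (hpq : p + q = 1) :
    ∑' a, f a ^ p * g a ^ q ≤ (∑' a, f a) ^ p * (∑' a, g a) ^ q := by
  let _ : MeasurableSpace α := ⊤
  simpa only [lintegral_count] using
    ENNReal.lintegral_mul_norm_pow_le (μ := Measure.count)
      (measurable_from_top (f := f)).aemeasurable (measurable_from_top (f := g)).aemeasurable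
      hp hq hpq

theorem ENNReal.tsum_prod_rpow_le {α ι : Type*} (s : Finset ι) (f : ι → α → ℝ≥0∞) {p : ι → ℝ}
    (hp : ∑ i ∈ s, p i = 1) (hp₀ : ∀ i ∈ s, 0 ≤ p i) :
    ∑' a, ∏ i ∈ s, f i a ^ p i ≤ ∏ i ∈ s, (∑' a, f i a) ^ p i := by
  let _ : MeasurableSpace α := ⊤
  simpa only [lintegral_count] using
    ENNReal.lintegral_prod_norm_pow_le (μ := Measure.count) s
      (fun i _ => (measurable_from_top (f := f i)).aemeasurable) hp hp₀

theorem ENNReal.tsum_fin_cons {α : Type*} {n : ℕ} (f : (Fin (n + 1) → α) → ℝ≥0∞) :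
    ∑' z, f z = ∑' t, ∑' y : Fin n → α, f (Fin.cons t y) := by
  rw [← ENNReal.tsum_prod, ← (Fin.consEquiv fun _ => α).tsum_eq]
  rfl

theorem Fin.removeNth_succ_cons {α : Type*} {n : ℕ} (i : Fin (n + 1)) (t : α)
    (y : Fin (n + 1) → α) :
    i.succ.removeNth (Fin.cons t y : Fin (n + 2) → α) = Fin.cons t (i.removeNth y) := by
  funext k
  refine Fin.cases ?_ (fun k => ?_) k <;> simp [Fin.removeNth]

/-- The Loomis–Whitney inequality for the counting measure on `α ^ (n + 1)`. -/
theorem ENNReal.tsum_prod_removeNth_rpow_le {α : Type*} {n : ℕ} (hn : 1 ≤ n)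
    (G : Fin (n + 1) → (Fin n → α) → ℝ≥0∞) :
    ∑' z : Fin (n + 1) → α, ∏ i, G i (i.removeNth z) ^ ((1 : ℝ) / n) ≤
      ∏ i, (∑' y, G i y) ^ ((1 : ℝ) / n) := by
  induction n, hn using Nat.le_induction with
  | base =>
    rw [ENNReal.tsum_fin_cons]
    have h (t : α) (y : Fin 1 → α) :
        (Fin.removeNth 1 (Fin.cons t y : Fin 2 → α)) = fun _ => t := by
      funext k
      rw [Subsingleton.elim k 0]
      rfl
    have hprod (F : Fin (1 + 1) → ℝ≥0∞) : ∏ i, F i = F 0 * F 1 := Fin.prod_univ_two F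
    simp only [hprod, Nat.cast_one, div_one, ENNReal.rpow_one, h,
      Fin.removeNth_zero, Fin.tail_cons, ENNReal.tsum_mul_right, ENNReal.tsum_mul_left]
    rw [← (Equiv.funUnique (Fin 1) α).symm.tsum_eq (G 1)]
    rfl
  | succ m hm ih =>
    have hm0 : (0 : ℝ) < m := by exact_mod_cast hm
    rw [ENNReal.tsum_fin_cons]
    set p : ℝ := 1 / ((m + 1 : ℕ) : ℝ) with hp
    have hp0 : 0 ≤ p := by positivity
    have hq : 1 / (m : ℝ) * (m * p) = p := by field_simp
    have hpq : p + m * p = 1 := by rw [hp]; push_cast; field_simp; ring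
    calc ∑' t, ∑' y : Fin (m + 1) → α,
          ∏ i, G i (i.removeNth (Fin.cons t y : Fin (m + 2) → α)) ^ p
        = ∑' t, ∑' y : Fin (m + 1) → α, G 0 y ^ p *
            (∏ i : Fin (m + 1), G i.succ (Fin.cons t (i.removeNth y)) ^ ((1 : ℝ) / m))
              ^ (m * p) := by
          refine tsum_congr fun t => tsum_congr fun y => ?_
          rw [Fin.prod_univ_succ, ← ENNReal.prod_rpow_of_nonneg (by positivity)]
          simp only [Fin.removeNth_succ_cons, ← ENNReal.rpow_mul, hq, Fin.removeNth_zero,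
            Fin.tail_cons]
      _ ≤ ∑' t, (∑' y, G 0 y) ^ p *
            (∏ i : Fin (m + 1), (∑' y, G i.succ (Fin.cons t y)) ^ ((1 : ℝ) / m)) ^ (m * p) := by
          refine ENNReal.tsum_le_tsum fun t =>
            (ENNReal.tsum_mul_rpow_le _ _ hp0 (by positivity) hpq).trans ?_
          gcongr
          exact ih fun i y => G i.succ (Fin.cons t y)
      _ = (∑' y, G 0 y) ^ p *
            ∑' t, ∏ i : Fin (m + 1), (∑' y, G i.succ (Fin.cons t y)) ^ p := by
          rw [← ENNReal.tsum_mul_left]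
          refine tsum_congr fun t => ?_
          rw [← ENNReal.prod_rpow_of_nonneg (by positivity)]
          simp only [← ENNReal.rpow_mul, hq]
      _ ≤ (∑' y, G 0 y) ^ p *
            ∏ i : Fin (m + 1), (∑' t, ∑' y, G i.succ (Fin.cons t y)) ^ p := by
          gcongr
          refine ENNReal.tsum_prod_rpow_le Finset.univ _ ?_ fun _ _ => hp0
          simp only [Finset.sum_const, Finset.card_univ, Fintype.card_fin, nsmul_eq_mul]
          push_cast
          linarith
      _ = ∏ i, (∑' y, G i y) ^ p := by
          rw [Fin.prod_univ_succ (n := m + 1)]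
          simp only [← ENNReal.tsum_fin_cons]

theorem hypProj_add_smul_self {d : ℕ} {v : EuclideanSpace ℝ (Fin d)} (hv : ‖v‖ = 1)
    (x : EuclideanSpace ℝ (Fin d)) (c : ℝ) : hypProj v (c • v + x) = hypProj v x := by
  simp only [hypProj, inner_add_left, real_inner_smul_left, real_inner_self_eq_norm_sq, hv]
  module

theorem sum_smul_injective_of_det_ne_zero {d : ℕ} {N : Fin d → EuclideanSpace ℝ (Fin d)}
    (hN : (Matrix.of fun a b : Fin d => N b a).det ≠ 0) :
    Function.Injective fun z : Fin d → ℝ => ∑ i, z i • N i := by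
  intro z w h
  refine sub_eq_zero.mp (Matrix.eq_zero_of_mulVec_eq_zero hN ?_)
  funext a
  have ha := congrArg (fun x : EuclideanSpace ℝ (Fin d) => x a) h
  simp only [WithLp.ofLp_sum, WithLp.ofLp_smul, Finset.sum_apply, Pi.smul_apply,
    smul_eq_mul] at ha
  simp only [Matrix.mulVec, dotProduct, Matrix.of_apply, Pi.sub_apply, mul_sub,
    Finset.sum_sub_distrib, Pi.zero_apply]
  simp only [mul_comm (N _ _)]
  linarith

/-- The projection along `N i` of the lattice point with coordinates `y` in the directions other
than `N i`. -/
noncomputable def projectedPoint {n : ℕ} (N : Fin (n + 1) → EuclideanSpace ℝ (Fin (n + 1)))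
    (i : Fin (n + 1)) (y : Fin n → ℤ) : EuclideanSpace ℝ (Fin (n + 1)) :=
  hypProj (N i) (∑ j, (y j : ℝ) • N (i.succAbove j))

theorem hypProj_sum_smul {n : ℕ} {N : Fin (n + 1) → EuclideanSpace ℝ (Fin (n + 1))}
    (i : Fin (n + 1)) (hi : ‖N i‖ = 1) (z : Fin (n + 1) → ℤ) :
    hypProj (N i) (∑ j, (z j : ℝ) • N j) = projectedPoint N i (i.removeNth z) := by
  rw [Fin.sum_univ_succAbove _ i, hypProj_add_smul_self hi]
  rfl

theorem projectedPoint_mem {n : ℕ} {N : Fin (n + 1) → EuclideanSpace ℝ (Fin (n + 1))}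
    (i : Fin (n + 1)) (hi : ‖N i‖ = 1) (y : Fin n → ℤ) :
    projectedPoint N i y ∈ hypProj (N i) '' obliqueLattice N := by
  refine ⟨_, ⟨i.insertNth (0 : ℤ) y, rfl⟩, ?_⟩
  simp only [hypProj_sum_smul i hi, Fin.removeNth_insertNth]

theorem projectedPoint_injective {n : ℕ} {N : Fin (n + 1) → EuclideanSpace ℝ (Fin (n + 1))}
    (hN : (Matrix.of fun a b : Fin (n + 1) => N b a).det ≠ 0) (i : Fin (n + 1)) :
    Function.Injective (projectedPoint N i) := by
  intro y w h
  simp only [projectedPoint, hypProj] at h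
  set c := ⟪∑ j, (y j : ℝ) • N (i.succAbove j), N i⟫_ℝ
  set c' := ⟪∑ j, (w j : ℝ) • N (i.succAbove j), N i⟫_ℝ
  have key := @sum_smul_injective_of_det_ne_zero _ N hN
    (i.insertNth (-c) fun j => (y j : ℝ)) (i.insertNth (-c') fun j => (w j : ℝ)) (by
      simp only [Fin.sum_univ_succAbove _ i, Fin.insertNth_apply_same,
        Fin.insertNth_apply_succAbove]
      rw [neg_smul, neg_smul, neg_add_eq_sub, neg_add_eq_sub, h])
  funext j
  simpa using congrFun key (i.succAbove j)

/-- the discrete Loomis–Whitney inequality on the oblique lattice generated by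
transversal unit vectors `N_1, …, N_{n+1}`:
`(∑_{z ∈ 𝓛} ∏_i |g_i(π_{N_i}(z))|^{2/n})^{n/2} ≤ C ∏_i ‖g_i‖_{l²(𝓛(𝓗_i))}`. -/
theorem discrete_loomis_whitney
    (n : ℕ) (hn : 1 ≤ n) (ν : ℝ) (hν : 0 < ν) :
    ∃ C : ℝ, 0 < C ∧
      ∀ N : Fin (n + 1) → EuclideanSpace ℝ (Fin (n + 1)),
        (∀ i, ‖N i‖ = 1) →
        ν ≤ |(Matrix.of fun a b : Fin (n + 1) => N b a).det| →
        ∀ g : Fin (n + 1) → EuclideanSpace ℝ (Fin (n + 1)) → ℂ,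
          (∑' z : ↥(obliqueLattice N),
              ∏ i, (‖g i (hypProj (N i) (z : EuclideanSpace ℝ (Fin (n + 1))))‖₊ : ℝ≥0∞) ^
                ((2 : ℝ) / n)) ^ ((n : ℝ) / 2) ≤
            ENNReal.ofReal C *
              ∏ i, (∑' s : ↥(hypProj (N i) '' obliqueLattice N),
                (‖g i (s : EuclideanSpace ℝ (Fin (n + 1)))‖₊ : ℝ≥0∞) ^ 2) ^ ((1 : ℝ) / 2) := by
  refine ⟨1, one_pos, fun N hN hdet g => ?_⟩
  have hdet0 : (Matrix.of fun a b : Fin (n + 1) => N b a).det ≠ 0 :=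
    abs_pos.mp (hν.trans_le hdet)
  have hn0 : (0 : ℝ) < n := by exact_mod_cast hn
  have hinj : Function.Injective fun z : Fin (n + 1) → ℤ => ∑ i, (z i : ℝ) • N i := by
    intro z w h
    have := sum_smul_injective_of_det_ne_zero hdet0 h
    funext j
    simpa using congrFun this j
  let G (i : Fin (n + 1)) (y : Fin n → ℤ) : ℝ≥0∞ := (‖g i (projectedPoint N i y)‖₊ : ℝ≥0∞) ^ 2
  have hsum : ∑' z : ↥(obliqueLattice N),
      ∏ i, (‖g i (hypProj (N i) (z : EuclideanSpace ℝ (Fin (n + 1))))‖₊ : ℝ≥0∞) ^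
        ((2 : ℝ) / n) = ∑' z : Fin (n + 1) → ℤ, ∏ i, G i (i.removeNth z) ^ ((1 : ℝ) / n) := by
    let e : (Fin (n + 1) → ℤ) ≃ ↥(obliqueLattice N) := Equiv.ofInjective _ hinj
    rw [← e.tsum_eq]
    refine tsum_congr fun z => Finset.prod_congr rfl fun i _ => ?_
    have he : (e z : EuclideanSpace ℝ (Fin (n + 1))) = ∑ i, (z i : ℝ) • N i := rfl
    rw [he, hypProj_sum_smul i (hN i)]
    simp only [G]
    rw [← ENNReal.rpow_natCast, ← ENNReal.rpow_mul]
    congr 1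
    push_cast
    ring
  have hG (i : Fin (n + 1)) : ∑' y, G i y ≤ ∑' s : ↥(hypProj (N i) '' obliqueLattice N),
      (‖g i (s : EuclideanSpace ℝ (Fin (n + 1)))‖₊ : ℝ≥0∞) ^ 2 :=
    ENNReal.tsum_comp_le_tsum_of_injective
      (f := fun y => (⟨projectedPoint N i y, projectedPoint_mem i (hN i) y⟩ :
        ↥(hypProj (N i) '' obliqueLattice N)))
      (fun _ _ h => projectedPoint_injective hdet0 i (congrArg Subtype.val h))
      fun s => (‖g i (s : EuclideanSpace ℝ (Fin (n + 1)))‖₊ : ℝ≥0∞) ^ 2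
  rw [hsum, ENNReal.ofReal_one, one_mul]
  calc _ ≤ (∏ i, (∑' y, G i y) ^ ((1 : ℝ) / n)) ^ ((n : ℝ) / 2) := by
        gcongr
        exact ENNReal.tsum_prod_removeNth_rpow_le hn G
    _ = ∏ i, (∑' y, G i y) ^ ((1 : ℝ) / 2) := by
        rw [← ENNReal.prod_rpow_of_nonneg (by positivity)]
        refine Finset.prod_congr rfl fun i _ => ?_
        rw [← ENNReal.rpow_mul]
        congr 1
        field_simp
    _ ≤ _ := by
        gcongr with i
        exact hG i
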